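/- Let g ≥ 1, n ≥ 1, 0 ≤ r ≤ g, and let a_1, …, a_r be nonzero elements of ℤ/n. Let ω : ℤ^{2g} × ℤ^{2g} → ℤ/n be the alternating ℤ-bilinear form determined on the standard basis e_1, …, e_{2g} by ω(e_i, e_{i+g}) = a_i and ω(e_{i+g}, e_i) = −a_i for 1 ≤ i ≤ r, and ω(e_i, e_j) = 0 for all other pairs i ≠ j. Then for every finite-index subgroup L ≤ ℤ^{2g} such that ω(x, y) = 0 for all x, y ∈ L, the product ∏_{i=1}^r Ann_ℤ(a_i) divides the index [ℤ^{2g} : L]. -/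

import Mathlib

/-- The index `i` viewed in `Fin (2*g)` (the basis vector `e_i`). -/
def idxL {g r : ℕ} (hr : r ≤ g) (i : Fin r) : Fin (2 * g) :=
  ⟨i.1, by have := i.2; omega⟩

/-- The index `i + g` viewed in `Fin (2*g)` (the basis vector `e_{i+g}`). -/
def idxH {g r : ℕ} (hr : r ≤ g) (i : Fin r) : Fin (2 * g) :=
  ⟨i.1 + g, by have := i.2; omega⟩

/-- The alternating `ℤ/n`-valued bilinear form on `ℤ^{2g}` determined by
`ω(e_i, e_{i+g}) = a_i`, `ω(e_{i+g}, e_i) = -a_i` for `1 ≤ i ≤ r`, and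
`ω(e_i, e_j) = 0` for all other pairs `i ≠ j`. -/
def omegaForm {g r n : ℕ} (hr : r ≤ g) (a : Fin r → ZMod n)
    (x y : Fin (2 * g) → ℤ) : ZMod n :=
  ∑ i : Fin r, a i *
    ((x (idxL hr i) * y (idxH hr i) - x (idxH hr i) * y (idxL hr i) : ℤ) : ZMod n)

/-- A finite abelian group has finitely many homomorphisms to `ℤ/n`, and their
number divides its order. -/
theorem card_addMonoidHom_zmod_dvd (Q : Type*) [AddCommGroup Q] [Finite Q] (n : ℕ) [NeZero n] :
    Nat.card (Q →+ ZMod n) ∣ Nat.card Q := by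
  let F : (Q →+ ZMod n) →+ AddChar Q ℂ :=
    AddMonoidHom.mk' (fun f => (ZMod.stdAddChar (N := n)).compAddMonoidHom f) fun f g => by
      ext x
      simp [AddChar.map_add_eq_mul]
  have hF : Function.Injective F := fun f g h => by
    ext x
    exact ZMod.injective_stdAddChar (DFunLike.congr_fun h x)
  have hcard : Nat.card (AddChar Q ℂ) = Nat.card Q := by
    have := Fintype.ofFinite Q
    rw [Nat.card_eq_fintype_card, Nat.card_eq_fintype_card, AddChar.card_eq]
  exact hcard ▸ AddSubgroup.card_dvd_of_injective F hF

/-- The index of the radical of a `ℤ/n`-valued form divides the square of the index of any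
isotropic subgroup of finite index. -/
theorem index_ker_dvd_index_sq_of_isotropic {M : Type*} [AddCommGroup M] {n : ℕ} [NeZero n]
    (B : M →+ M →+ ZMod n) (L : AddSubgroup M) (hL : L.index ≠ 0)
    (hB : ∀ x ∈ L, ∀ y ∈ L, B x y = 0) : B.ker.index ∣ L.index ^ 2 := by
  have : Finite (M ⧸ L) := @AddSubgroup.finite_quotient_of_finiteIndex _ _ L ⟨hL⟩
  let ψ : L →+ (M ⧸ L →+ ZMod n) :=
    AddMonoidHom.mk' (fun x => QuotientAddGroup.lift L (B x) fun y hy => hB x x.2 y hy)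
      fun x y => by
        ext z
        exact DFunLike.congr_fun (map_add B (x : M) y) z
  have hker : ψ.ker ≤ B.ker.addSubgroupOf L := fun x hx => by
    rw [AddSubgroup.mem_addSubgroupOf, AddMonoidHom.mem_ker]
    ext y
    exact DFunLike.congr_fun (AddMonoidHom.mem_ker.1 hx) (y : M ⧸ L)
  have hrel : B.ker.relIndex L ∣ L.index :=
    calc B.ker.relIndex L ∣ ψ.ker.index := AddSubgroup.index_dvd_of_le hker
      _ = Nat.card ψ.range := AddSubgroup.index_ker ψ
      _ ∣ Nat.card (M ⧸ L →+ ZMod n) := AddSubgroup.card_addSubgroup_dvd_card _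
      _ ∣ L.index := card_addMonoidHom_zmod_dvd _ n
  calc B.ker.index ∣ (B.ker ⊓ L).index := AddSubgroup.index_dvd_of_le inf_le_left
    _ = B.ker.relIndex L * L.index := by
      rw [← AddSubgroup.inf_relIndex_right, AddSubgroup.relIndex_mul_index inf_le_right]
    _ ∣ L.index ^ 2 := sq L.index ▸ Nat.mul_dvd_mul_right hrel _

/-- The vectors of `ℤ^κ` whose coordinates along an injection `e` annihilate the elements `b i`
form a subgroup whose index is the product of the additive orders of the `b i`. -/
theorem index_of_mem_iff_zsmul_eq_zero {ι κ A : Type*} [Fintype ι] [AddCommGroup A]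
    {e : ι → κ} (he : Function.Injective e) (b : ι → A) (K : AddSubgroup (κ → ℤ))
    (hK : ∀ x, x ∈ K ↔ ∀ i, x (e i) • b i = 0) : K.index = ∏ i, addOrderOf (b i) := by
  let φ : (κ → ℤ) →+ ∀ i, AddSubgroup.zmultiples (b i) :=
    AddMonoidHom.mk' (fun x i => ⟨x (e i) • b i, x (e i), rfl⟩) fun x y => by
      ext i
      simp [add_smul]
  have hφ : Function.Surjective φ := fun z => by
    choose s hs using fun i => (z i).2
    obtain ⟨x, hx⟩ := he.surjective_comp_right s
    refine ⟨x, funext fun i => Subtype.ext ?_⟩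
    rw [← hs i, ← hx]
    rfl
  have hker : K = φ.ker := by
    ext x
    rw [hK, AddMonoidHom.mem_ker, funext_iff]
    exact forall_congr' fun i => (Subtype.ext_iff (a1 := φ x i) (a2 := 0)).symm
  rw [hker, AddSubgroup.index_ker, AddMonoidHom.range_eq_top.2 hφ, AddSubgroup.card_top,
    Nat.card_pi]
  simp

theorem sumElim_idxL_idxH_injective {g r : ℕ} (hr : r ≤ g) :
    Function.Injective (Sum.elim (idxL hr) (idxH hr)) := by
  rintro (i | i) (j | j) h <;> simp [idxL, idxH, Fin.ext_iff] at h ⊢ <;> omega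

/-- `omegaForm` as a bundled biadditive map. -/
def omegaHom {g r n : ℕ} (hr : r ≤ g) (a : Fin r → ZMod n) :
    (Fin (2 * g) → ℤ) →+ (Fin (2 * g) → ℤ) →+ ZMod n :=
  AddMonoidHom.mk' (fun x => AddMonoidHom.mk' (omegaForm hr a x) fun y z => by
      simp only [omegaForm, ← Finset.sum_add_distrib]
      refine Finset.sum_congr rfl fun i _ => ?_
      simp only [Pi.add_apply]
      push_cast
      ring) fun x y => by
    refine AddMonoidHom.ext fun z => ?_
    simp only [omegaForm, AddMonoidHom.mk'_apply, AddMonoidHom.add_apply,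
      ← Finset.sum_add_distrib]
    refine Finset.sum_congr rfl fun i _ => ?_
    simp only [Pi.add_apply]
    push_cast
    ring

theorem omegaForm_single_idxL {g r n : ℕ} (hr : r ≤ g) (a : Fin r → ZMod n)
    (x : Fin (2 * g) → ℤ) (i : Fin r) :
    omegaForm hr a x (Pi.single (idxL hr i) 1) = -(x (idxH hr i) • a i) := by
  have hne (j : Fin r) : idxH hr j ≠ idxL hr i := fun h =>
    Sum.inr_ne_inl (sumElim_idxL_idxH_injective hr (a₁ := .inr j) (a₂ := .inl i) h)
  have hinj (j : Fin r) : idxL hr j = idxL hr i ↔ j = i := by simp [idxL, Fin.ext_iff]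
  simp [omegaForm, Pi.single_apply, hne, hinj, mul_comm]

theorem omegaForm_single_idxH {g r n : ℕ} (hr : r ≤ g) (a : Fin r → ZMod n)
    (x : Fin (2 * g) → ℤ) (i : Fin r) :
    omegaForm hr a x (Pi.single (idxH hr i) 1) = x (idxL hr i) • a i := by
  have hne (j : Fin r) : idxL hr j ≠ idxH hr i := fun h =>
    Sum.inl_ne_inr (sumElim_idxL_idxH_injective hr (a₁ := .inl j) (a₂ := .inr i) h)
  have hinj (j : Fin r) : idxH hr j = idxH hr i ↔ j = i := by simp [idxH, Fin.ext_iff]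
  simp [omegaForm, Pi.single_apply, hne, hinj, mul_comm]

theorem mem_ker_omegaHom_iff {g r n : ℕ} (hr : r ≤ g) (a : Fin r → ZMod n)
    (x : Fin (2 * g) → ℤ) :
    x ∈ (omegaHom hr a).ker ↔
      ∀ i, x (Sum.elim (idxL hr) (idxH hr) i) • Sum.elim a a i = 0 := by
  rw [AddMonoidHom.mem_ker]
  refine ⟨fun h => ?_, fun h => AddMonoidHom.ext fun y => ?_⟩
  · have h' (y : Fin (2 * g) → ℤ) : omegaForm hr a x y = 0 := DFunLike.congr_fun h y
    rintro (i | i)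
    · exact (omegaForm_single_idxH hr a x i).symm.trans (h' _)
    · exact neg_eq_zero.1 ((omegaForm_single_idxL hr a x i).symm.trans (h' _))
  · change omegaForm hr a x y = 0
    refine Finset.sum_eq_zero fun i _ => ?_
    have h₁ := h (.inl i)
    have h₂ := h (.inr i)
    simp only [Sum.elim_inl, Sum.elim_inr, zsmul_eq_mul] at h₁ h₂
    push_cast
    linear_combination (y (idxH hr i) : ZMod n) * h₁ - (y (idxL hr i) : ZMod n) * h₂

theorem annihilator_lower_bound (g n r : ℕ) (hg : 1 ≤ g) (hn : 1 ≤ n)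
    (hr : r ≤ g) (a : Fin r → ZMod n) (ha : ∀ i, a i ≠ 0)
    (L : AddSubgroup (Fin (2 * g) → ℤ)) (hL : L.index ≠ 0)
    (hvanish : ∀ x ∈ L, ∀ y ∈ L, omegaForm hr a x y = 0) :
    (∏ i : Fin r, addOrderOf (a i)) ∣ L.index := by
  have : NeZero n := ⟨by omega⟩
  have h := index_ker_dvd_index_sq_of_isotropic (omegaHom hr a) L hL hvanish
  rw [index_of_mem_iff_zsmul_eq_zero (sumElim_idxL_idxH_injective hr) (Sum.elim a a) _
    (mem_ker_omegaHom_iff hr a), Fintype.prod_sum_type] at h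
  simp only [Sum.elim_inl, Sum.elim_inr, ← sq] at h
  exact (Nat.pow_dvd_pow_iff two_ne_zero).1 h
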